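/- Let (Ω, F, P) be a probability space with a filtration (F_k)_{k∈ℕ}, let (v_k)_{k∈ℕ} be a sequence of nonnegative, integrable, adapted real-valued random variables and (a_k)_{k∈ℕ} a sequence of nonnegative, integrable, adapted real-valued random variables satisfying the discrete Lyapunov drift condition E[v_{k+1} | F_k] ≤ v_k − a_k almost surely for every k. Let (x_k)_{k∈ℕ} be a sequence of adapted, square-integrable random vectors with values in ℝ^m, and suppose there are constants c₂ > 0 and c₃ > 0 such that v_k ≤ c₂‖x_k‖² and c₃‖x_k‖² ≤ a_k almost surely for every k. Then ∑_{k=0}^{∞} E[‖x_k‖²] ≤ (c₂/c₃) · E[‖x_0‖²]; in particular E[‖x_k‖²] → 0 as k → ∞. -/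

import Mathlib

open MeasureTheory Filter

/-- Summed drift estimate: `∑_{k < n} E[a_k] ≤ E[v_0]` for a nonnegative Lyapunov sequence. -/
theorem sum_integral_le_of_condExp_le_sub
    {Ω : Type*} {m0 : MeasurableSpace Ω} {μ : Measure Ω} [IsFiniteMeasure μ]
    (ℱ : Filtration ℕ m0) {v a : ℕ → Ω → ℝ}
    (hv_nonneg : ∀ k, 0 ≤ᵐ[μ] v k) (hv_int : ∀ k, Integrable (v k) μ)
    (ha_int : ∀ k, Integrable (a k) μ)
    (hdrift : ∀ k, μ[v (k + 1) | ℱ k] ≤ᵐ[μ] v k - a k) (n : ℕ) :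
    ∑ k ∈ Finset.range n, ∫ ω, a k ω ∂μ ≤ ∫ ω, v 0 ω ∂μ := by
  have hstep (k : ℕ) : ∫ ω, v (k + 1) ω ∂μ ≤ ∫ ω, v k ω ∂μ - ∫ ω, a k ω ∂μ := by
    rw [← integral_condExp (ℱ.le k), ← integral_sub (hv_int k) (ha_int k)]
    exact integral_mono_ae integrable_condExp ((hv_int k).sub (ha_int k)) (hdrift k)
  have hsum : ∑ k ∈ Finset.range n, ∫ ω, a k ω ∂μ + ∫ ω, v n ω ∂μ ≤ ∫ ω, v 0 ω ∂μ := by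
    induction n with
    | zero => simp
    | succ n ih =>
      rw [Finset.sum_range_succ]
      linarith [hstep n]
  linarith [integral_nonneg_of_ae (hv_nonneg n)]

/-- Asymptotic mean-square stability part of Theorem 3: the discrete Lyapunov drift
condition together with the quadratic bounds `v_k ≤ c₂‖x_k‖²` and `c₃‖x_k‖² ≤ a_k`
yields `∑_{k=0}^{∞} E[‖x_k‖²] ≤ (c₂/c₃) E[‖x_0‖²]`; in particular
`E[‖x_k‖²] → 0` as `k → ∞`. -/
theorem asymptotic_mean_square_stability
    {Ω : Type*} {m0 : MeasurableSpace Ω} {μ : Measure Ω} [IsProbabilityMeasure μ]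
    (ℱ : Filtration ℕ m0) {m : ℕ}
    (v a : ℕ → Ω → ℝ)
    (hv_nonneg : ∀ k, 0 ≤ᵐ[μ] v k) (hv_int : ∀ k, Integrable (v k) μ)
    (hv_adapted : StronglyAdapted ℱ v)
    (ha_nonneg : ∀ k, 0 ≤ᵐ[μ] a k) (ha_int : ∀ k, Integrable (a k) μ)
    (ha_adapted : StronglyAdapted ℱ a)
    (hdrift : ∀ k, μ[v (k + 1) | ℱ k] ≤ᵐ[μ] v k - a k)
    (x : ℕ → Ω → EuclideanSpace ℝ (Fin m)) (hx_adapted : StronglyAdapted ℱ x)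
    (hx_L2 : ∀ k, MemLp (x k) 2 μ)
    (c₂ c₃ : ℝ) (hc₂ : 0 < c₂) (hc₃ : 0 < c₃)
    (hhigh : ∀ k, ∀ᵐ ω ∂μ, v k ω ≤ c₂ * ‖x k ω‖ ^ 2)
    (hlow : ∀ k, ∀ᵐ ω ∂μ, c₃ * ‖x k ω‖ ^ 2 ≤ a k ω) :
    Summable (fun k => ∫ ω, ‖x k ω‖ ^ 2 ∂μ) ∧
      ∑' k : ℕ, ∫ ω, ‖x k ω‖ ^ 2 ∂μ ≤ (c₂ / c₃) * ∫ ω, ‖x 0 ω‖ ^ 2 ∂μ ∧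
      Tendsto (fun k => ∫ ω, ‖x k ω‖ ^ 2 ∂μ) atTop (nhds 0) := by
  have hx_int (k : ℕ) : Integrable (fun ω => ‖x k ω‖ ^ 2) μ :=
    (hx_L2 k).integrable_norm_pow two_ne_zero
  have hlow' (k : ℕ) : c₃ * ∫ ω, ‖x k ω‖ ^ 2 ∂μ ≤ ∫ ω, a k ω ∂μ := by
    rw [← integral_const_mul]
    exact integral_mono_ae ((hx_int k).const_mul c₃) (ha_int k) (hlow k)
  have hhigh' : ∫ ω, v 0 ω ∂μ ≤ c₂ * ∫ ω, ‖x 0 ω‖ ^ 2 ∂μ := by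
    rw [← integral_const_mul]
    exact integral_mono_ae (hv_int 0) ((hx_int 0).const_mul c₂) (hhigh 0)
  have hnonneg (k : ℕ) : 0 ≤ ∫ ω, ‖x k ω‖ ^ 2 ∂μ := integral_nonneg fun ω => by positivity
  have hbound (n : ℕ) : ∑ k ∈ Finset.range n, ∫ ω, ‖x k ω‖ ^ 2 ∂μ ≤
      (c₂ / c₃) * ∫ ω, ‖x 0 ω‖ ^ 2 ∂μ := by
    rw [div_mul_eq_mul_div, le_div_iff₀' hc₃, Finset.mul_sum]
    calc ∑ k ∈ Finset.range n, c₃ * ∫ ω, ‖x k ω‖ ^ 2 ∂μ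
        ≤ ∑ k ∈ Finset.range n, ∫ ω, a k ω ∂μ := Finset.sum_le_sum fun k _ => hlow' k
      _ ≤ ∫ ω, v 0 ω ∂μ := sum_integral_le_of_condExp_le_sub ℱ hv_nonneg hv_int ha_int hdrift n
      _ ≤ c₂ * ∫ ω, ‖x 0 ω‖ ^ 2 ∂μ := hhigh'
  have hsummable := summable_of_sum_range_le hnonneg hbound
  exact ⟨hsummable, Real.tsum_le_of_sum_range_le hnonneg hbound, hsummable.tendsto_atTop_zero⟩
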